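/- Let G be the complete graph on n vertices, and let a, b, m, Δ be non-negative integers with b − Δ ≥ a ≥ 2 and n > (a+b)(a+b+2m−2)/(a+Δ). Then G is a fractional (a,b,m)-deleted graph. -/

import Mathlib

open Classical Finset

/-- The fractional degree `d_G^h(x)` of a vertex: the sum of `h e` over all edges
(unordered pairs) containing `x`. -/
noncomputable def fracDeg {V : Type*} [Fintype V] [DecidableEq V]
    (h : Sym2 V → ℝ) (x : V) : ℝ :=
  ∑ e ∈ Finset.univ.filter (fun e : Sym2 V => x ∈ e), h e

/-- `G` admits a fractional `(g,f)`-factor: a weighting `h : E(G) → [0,1]`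
(extended by `0` off the edge set) with `g x ≤ d_G^h(x) ≤ f x` for every vertex. -/
def HasFracFactor {V : Type*} [Fintype V] [DecidableEq V]
    (G : SimpleGraph V) (g f : V → ℤ) : Prop :=
  ∃ h : Sym2 V → ℝ,
    (∀ e, 0 ≤ h e ∧ h e ≤ 1) ∧
    (∀ e, e ∉ G.edgeSet → h e = 0) ∧
    (∀ x : V, (g x : ℝ) ≤ fracDeg h x ∧ fracDeg h x ≤ (f x : ℝ))

/-- `G` is a fractional `(g,f,m)`-deleted graph: after deleting any `m` edges,
the resulting graph admits a fractional `(g,f)`-factor. -/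
def FracDeleted {V : Type*} [Fintype V] [DecidableEq V]
    (G : SimpleGraph V) (g f : V → ℤ) (m : ℕ) : Prop :=
  ∀ H : Finset (Sym2 V), ↑H ⊆ G.edgeSet → H.card = m →
    HasFracFactor (G.deleteEdges ↑H) g f

/-- `G` is a fractional `(g,f,n',m)`-critical deleted graph: after deleting any `n'`
vertices, the resulting induced graph is a fractional `(g,f,m)`-deleted graph. -/
def FracCriticalDeleted {V : Type*} [Fintype V] [DecidableEq V]
    (G : SimpleGraph V) (g f : V → ℤ) (n' m : ℕ) : Prop :=
  ∀ U : Finset V, U.card = n' →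
    FracDeleted (G.induce ((↑U : Set V)ᶜ)) (fun x => g x.1) (fun x => f x.1) m

/-- `G` is a fractional ID-`(g,f,m)`-deleted graph: after deleting any independent set
of vertices, the resulting induced graph is a fractional `(g,f,m)`-deleted graph. -/
def FracIDDeleted {V : Type*} [Fintype V] [DecidableEq V]
    (G : SimpleGraph V) (g f : V → ℤ) (m : ℕ) : Prop :=
  ∀ I : Set V, (∀ u ∈ I, ∀ v ∈ I, ¬ G.Adj u v) →
    FracDeleted (G.induce Iᶜ) (fun x => g x.1) (fun x => f x.1) m

/-- A relation with at most half of each row and column forbidden can be avoided by a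
permutation. -/
theorem exists_perm_avoiding {V : Type*} [Fintype V] (F : V → V → Prop) (D : ℕ)
    (hrow : ∀ u, #{v | F u v} ≤ D) (hcol : ∀ v, #{u | F u v} ≤ D)
    (hD : 2 * D ≤ Fintype.card V) :
    ∃ σ : Equiv.Perm V, ∀ u, ¬ F u (σ u) := by
  let t : V → Finset V := fun u => {v | ¬ F u v}
  have ht : ∀ A : Finset V, #A ≤ #(A.biUnion t) := by
    intro A
    by_cases hN : A.biUnion t = univ
    · rw [hN]
      exact card_le_univ A
    obtain ⟨y, hy⟩ : ∃ y, y ∉ A.biUnion t := by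
      by_contra! h
      exact hN (eq_univ_iff_forall.2 h)
    rcases A.eq_empty_or_nonempty with rfl | ⟨u, hu⟩
    · simp
    have hA : #A ≤ D := by
      refine (card_le_card fun w hw => ?_).trans (hcol y)
      by_contra hF
      exact hy (mem_biUnion.2 ⟨w, hw, by simpa [t] using hF⟩)
    have htu : #(t u) ≤ #(A.biUnion t) := card_le_card (subset_biUnion_of_mem t hu)
    have hsplit := card_filter_add_card_filter_not (s := (univ : Finset V)) (fun v => F u v)
    have := hrow u
    simp only [card_univ] at hsplit
    simp only [t] at htu ⊢
    omega
  obtain ⟨f, hf, hft⟩ := (all_card_le_biUnion_card_iff_exists_injective t).1 ht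
  exact ⟨Equiv.ofBijective f (Finite.injective_iff_bijective.1 hf),
    fun u => by simpa [t] using hft u⟩

theorem card_filter_or_le {α : Type*} [Fintype α] (p q : α → Prop)
    [DecidablePred p] [DecidablePred q] :
    #{x | p x ∨ q x} ≤ #{x | p x} + #{x | q x} := by
  refine le_trans (card_le_card fun x hx => ?_) (card_union_le {x | p x} {x | q x})
  simpa using hx

theorem card_filter_or_of_disjoint {α : Type*} [Fintype α] (p q : α → Prop)
    [DecidablePred p] [DecidablePred q]
    (h : ∀ x, p x → ¬ q x) :
    #{x | p x ∨ q x} = #{x | p x} + #{x | q x} := by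
  rw [← card_union_of_disjoint (disjoint_filter.2 fun x _ => h x)]
  congr 1
  ext x
  simp

/-- Greedily collecting disjoint permutations gives a `k`-regular relation avoiding a sparse one. -/
theorem exists_regular_rel_avoiding {V : Type*} [Fintype V] (k : ℕ) :
    ∀ (F : V → V → Prop) (D : ℕ), (∀ u, #{v | F u v} ≤ D) → (∀ v, #{u | F u v} ≤ D) →
      2 * (D + k) ≤ Fintype.card V + 2 →
      ∃ R : V → V → Prop, (∀ u v, R u v → ¬ F u v) ∧
        (∀ u, #{v | R u v} = k) ∧ ∀ v, #{u | R u v} = k := by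
  induction k with
  | zero => exact fun F D _ _ _ => ⟨fun _ _ => False, by simp, by simp, by simp⟩
  | succ k ih =>
    intro F D hrow hcol hD
    obtain ⟨σ, hσ⟩ := exists_perm_avoiding F D hrow hcol (by omega)
    have hσrow : ∀ u, #{v | σ u = v} = 1 := fun u => card_eq_one.2 ⟨σ u, by ext; simp [eq_comm]⟩
    have hσcol : ∀ v, #{u | σ u = v} = 1 := fun v =>
      card_eq_one.2 ⟨σ.symm v, by ext; simp [Equiv.eq_symm_apply]⟩
    obtain ⟨R, hR, hRrow, hRcol⟩ := ih (fun u v => F u v ∨ σ u = v) (D + 1)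
      (fun u => by
        convert Nat.le_trans (card_filter_or_le _ _) (add_le_add (hrow u) (hσrow u).le))
      (fun v => by
        convert Nat.le_trans (card_filter_or_le _ _) (add_le_add (hcol v) (hσcol v).le))
      (by omega)
    refine ⟨fun u v => R u v ∨ σ u = v, ?_, fun u => ?_, fun v => ?_⟩
    · rintro u v (h | rfl) hF
      · exact hR u v h (Or.inl hF)
      · exact hσ u hF
    · convert (card_filter_or_of_disjoint _ _ fun v h h' => hR u v h (Or.inr h')).trans
        (congrArg₂ _ (hRrow u) (hσrow u))
    · convert (card_filter_or_of_disjoint _ _ fun u h h' => hR u v h (Or.inr h')).trans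
        (congrArg₂ _ (hRcol v) (hσcol v))

theorem fracDeg_eq_sum {V : Type*} [Fintype V] [DecidableEq V] (h : Sym2 V → ℝ) (x : V) :
    fracDeg h x = ∑ v, h s(x, v) := by
  symm
  refine sum_bij (fun v _ => s(x, v)) (by simp) (fun v _ w _ h => Sym2.congr_right.1 h) ?_
    fun _ _ => rfl
  intro e he
  obtain ⟨v, rfl⟩ := (mem_filter.1 he).2
  exact ⟨v, mem_univ _, rfl⟩

/-- Symmetrising a `k`-regular relation supported on `G` gives a fractional factor. -/
theorem hasFracFactor_of_regular_rel {V : Type*} [Fintype V] [DecidableEq V]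
    (G : SimpleGraph V) (k : ℕ) (g f : V → ℤ) (hg : ∀ x, g x ≤ k) (hf : ∀ x, k ≤ f x)
    (R : V → V → Prop) (hR : ∀ u v, R u v → G.Adj u v)
    (hrow : ∀ u, #{v | R u v} = k) (hcol : ∀ v, #{u | R u v} = k) :
    HasFracFactor G g f := by
  let h : Sym2 V → ℝ := Sym2.lift
    ⟨fun u v => ((if R u v then 1 else 0) + if R v u then 1 else 0) / 2,
      fun u v => congrArg (· / 2) (add_comm _ _)⟩
  have hdeg : ∀ x, fracDeg h x = k := by
    intro x
    rw [fracDeg_eq_sum]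
    simp only [h, Sym2.lift_mk]
    rw [← sum_div, sum_add_distrib, sum_boole, sum_boole, hrow, hcol]
    ring
  refine ⟨h, fun e => ?_, fun e he => ?_, fun x => ?_⟩
  · induction e with | _ u v
    simp only [h, Sym2.lift_mk]
    split_ifs <;> norm_num
  · induction e with | _ u v
    rw [SimpleGraph.mem_edgeSet] at he
    have h₁ : ¬ R u v := fun h => he (hR u v h)
    have h₂ : ¬ R v u := fun h => he (hR v u h).symm
    simp [h, h₁, h₂]
  · rw [hdeg]
    exact ⟨by exact_mod_cast hg x, by exact_mod_cast hf x⟩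

theorem statement_10 {V : Type*} [Fintype V] [DecidableEq V]
    (a b m Δ : ℕ)
    (hba : a + Δ ≤ b) (ha : 2 ≤ a)
    (hn : (Fintype.card V : ℝ) >
      ((a : ℝ) + b) * ((a : ℝ) + b + 2 * m - 2) / ((a : ℝ) + Δ)) :
    FracDeleted (⊤ : SimpleGraph V) (fun _ => (a : ℤ)) (fun _ => (b : ℤ)) m := by
  intro H _ hHm
  have hab : (a : ℝ) + Δ ≤ b := by exact_mod_cast hba
  have ha' : (2 : ℝ) ≤ a := by exact_mod_cast ha
  have hΔ : (0 : ℝ) ≤ Δ := Nat.cast_nonneg Δ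
  have hm : (0 : ℝ) ≤ m := Nat.cast_nonneg m
  have hcard : 2 * a + 2 * m < Fintype.card V := by
    rw [gt_iff_lt, div_lt_iff₀ (by linarith)] at hn
    have h₁ : (Fintype.card V : ℝ) * (a + Δ) ≤ Fintype.card V * b :=
      mul_le_mul_of_nonneg_left hab (Nat.cast_nonneg _)
    have h₂ : (2 * a + 2 * m : ℝ) < Fintype.card V := by
      by_contra! hle
      have h₃ : (Fintype.card V : ℝ) * b ≤ (2 * a + 2 * m) * b :=
        mul_le_mul_of_nonneg_right hle (by linarith)
      nlinarith [mul_nonneg hm (by linarith : (0 : ℝ) ≤ a)]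
    exact_mod_cast h₂
  have hHrow : ∀ u, #{v | s(u, v) ∈ H} ≤ m := fun u => hHm ▸
    card_le_card_of_injOn (fun v => s(u, v)) (fun v hv => by simpa using hv)
      fun v _ w _ h => Sym2.congr_right.1 h
  have hrow : ∀ u, #{v | u = v ∨ s(u, v) ∈ H} ≤ m + 1 := by
    intro u
    rw [add_comm m]
    refine (card_filter_or_le _ _).trans (add_le_add ?_ (hHrow u))
    simp [filter_eq]
  obtain ⟨R, hR, hRrow, hRcol⟩ := exists_regular_rel_avoiding a
    (fun u v : V => u = v ∨ s(u, v) ∈ H) (m + 1) (fun u => by convert hrow u)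
    (fun v => by
      convert hrow v using 4 with u
      · exact eq_comm
      · rw [Sym2.eq_swap (a := u)]) (by omega)
  refine hasFracFactor_of_regular_rel _ a _ _ (fun _ => le_rfl)
    (fun _ => by exact_mod_cast (Nat.le_add_right a Δ).trans hba) R (fun u v h => ?_)
    hRrow hRcol
  have := hR u v h
  simpa [SimpleGraph.deleteEdges_adj, not_or] using this
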